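/- (Superadditivity of entropy gain I.) Let D ≥ 1 and let ι_A, ι_B, ι_{A'}, ι_{B'}, ι be finite types. For each d ∈ Fin D let φ_d be a quantum channel from matrices on ℂ^{ι_A × ι_B} to matrices on ℂ^{ι_{A'} × ι_{B'}}, given by Kraus operators K_{d,i} ∈ Matrix (ι_{A'} × ι_{B'}) (ι_A × ι_B) ℂ, i ∈ ι, with ∑_i K_{d,i}ᴴ K_{d,i} = 1. Let ρ be a density matrix on the index type (Fin D → ι_A) × (Fin D → ι_B), regarded as a state on the D-fold tensor product of the bipartite systems A_d B_d, and for each d let ρ_d be its reduced density matrix on the d-th pair (A_d, B_d), obtained by partial trace over all other factors. Let ⊗_d φ_d be the tensor-product channel, whose Kraus operators, indexed by tuples i : Fin D → ι, have entries given by the product over d of the entries of K_{d, i(d)} at the d-th coordinates. Then the entropy gain is superadditive: S((⊗_d φ_d)(ρ)) − S(ρ) ≥ ∑_{d} [S(φ_d(ρ_d)) − S(ρ_d)]. -/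

import Mathlib

open Matrix Kronecker BigOperators ComplexOrder

noncomputable section

/-- A density matrix: positive semidefinite with unit trace. -/
def IsDensityMatrix {ι : Type*} [Fintype ι] (ρ : Matrix ι ι ℂ) : Prop :=
  ρ.PosSemidef ∧ ρ.trace = 1

/-- Von Neumann entropy of a (Hermitian) matrix: `∑ i, negMulLog (λ i)`. -/
noncomputable def vnEntropy {ι : Type*} [Fintype ι] [DecidableEq ι] (ρ : Matrix ι ι ℂ) : ℝ :=
  if h : ρ.IsHermitian then ∑ i, Real.negMulLog (h.eigenvalues i) else 0

/-- Action of a quantum channel given by Kraus operators. -/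
noncomputable def chanApply {ι κ X : Type*} [Fintype ι] [Fintype X]
    (K : X → Matrix κ ι ℂ) (ρ : Matrix ι ι ℂ) : Matrix κ κ ℂ :=
  ∑ x, K x * ρ * (K x)ᴴ

/-- The Kraus operators of the `D`-fold tensor product channel `⊗_d φ_d`: indexed by
tuples, with entries given by products of entries of the individual Kraus operators. -/
def tensorKraus {D : ℕ} {ιA ιB ιA' ιB' ι : Type*}
    (K : Fin D → ι → Matrix (ιA' × ιB') (ιA × ιB) ℂ) (i : Fin D → ι) :
    Matrix ((Fin D → ιA') × (Fin D → ιB')) ((Fin D → ιA) × (Fin D → ιB)) ℂ :=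
  fun p q => ∏ d, K d (i d) (p.1 d, p.2 d) (q.1 d, q.2 d)

/-- The reduced density matrix of a `D`-partite bipartite state on the `d`-th pair
`(A_d, B_d)`, obtained by partial trace over all other factors. -/
noncomputable def reducePair {D : ℕ} {ιA ιB : Type*} [Fintype ιA] [Fintype ιB]
    [DecidableEq ιA] [DecidableEq ιB]
    (ρ : Matrix ((Fin D → ιA) × (Fin D → ιB)) ((Fin D → ιA) × (Fin D → ιB)) ℂ)
    (d : Fin D) : Matrix (ιA × ιB) (ιA × ιB) ℂ :=
  fun p q => ∑ f : Fin D → ιA, ∑ g : Fin D → ιB,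
    if f d = q.1 ∧ g d = q.2 then
      ρ (Function.update f d p.1, Function.update g d p.2) (f, g) else 0

/-- The tensor product of a family of matrices on bipartite systems. -/
def piKron {D : ℕ} {α β α' β' : Type*} (M : Fin D → Matrix (α' × β') (α × β) ℂ) :
    Matrix ((Fin D → α') × (Fin D → β')) ((Fin D → α) × (Fin D → β)) ℂ :=
  fun p q => ∏ d, M d (p.1 d, p.2 d) (q.1 d, q.2 d)

section PiKron

variable {D : ℕ} {α β α' β' α'' β'' : Type*}

theorem sum_prod_pair [Fintype α] [Fintype β] (F : Fin D → α × β → ℂ) :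
    ∑ p : (Fin D → α) × (Fin D → β), ∏ d, F d (p.1 d, p.2 d) = ∏ d, ∑ a, F d a := by
  rw [Fintype.prod_sum]
  exact Fintype.sum_equiv (Equiv.arrowProdEquivProdArrow _ _ _).symm _ _ fun _ => rfl

theorem piKron_mul [Fintype α'] [Fintype β']
    (M : Fin D → Matrix (α'' × β'') (α' × β') ℂ) (N : Fin D → Matrix (α' × β') (α × β) ℂ) :
    piKron M * piKron N = piKron fun d => M d * N d := by
  ext p q
  simp only [piKron, mul_apply, ← Finset.prod_mul_distrib]
  exact sum_prod_pair fun d a => M d (p.1 d, p.2 d) a * N d a (q.1 d, q.2 d)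

theorem piKron_conjTranspose (M : Fin D → Matrix (α' × β') (α × β) ℂ) :
    (piKron M)ᴴ = piKron fun d => (M d)ᴴ := by
  ext p q
  simp [piKron, conjTranspose_apply]

theorem piKron_diagonal [DecidableEq α] [DecidableEq β] (q : Fin D → α × β → ℂ) :
    piKron (fun d => diagonal (q d)) = diagonal fun j => ∏ d, q d (j.1 d, j.2 d) := by
  ext i j
  simp only [piKron, diagonal_apply]
  split_ifs with h
  · subst h; simp
  · have : ∃ d, ¬(i.1 d, i.2 d) = (j.1 d, j.2 d) := by
      by_contra! hc
      exact h (Prod.ext (funext fun d => congrArg Prod.fst (hc d))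
        (funext fun d => congrArg Prod.snd (hc d)))
    obtain ⟨d, hd⟩ := this
    exact Finset.prod_eq_zero (Finset.mem_univ d) (if_neg hd)

theorem piKron_one [DecidableEq α] [DecidableEq β] :
    piKron (1 : Fin D → Matrix (α × β) (α × β) ℂ) = 1 := by
  have h := piKron_diagonal (D := D) (α := α) (β := β) fun _ _ => 1
  simp only [diagonal_one, Finset.prod_const_one] at h
  exact h

theorem sum_piKron {ι : Type*} [Fintype ι] (M : Fin D → ι → Matrix (α' × β') (α × β) ℂ) :
    ∑ i : Fin D → ι, piKron (fun d => M d (i d)) = piKron fun d => ∑ i, M d i := by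
  ext p q
  simp only [piKron, Matrix.sum_apply, Fintype.prod_sum]

end PiKron

section Channel

variable {ι κ X : Type*} [Fintype X]

theorem chanApply_posSemidef [Fintype ι] [Fintype κ] (K : X → Matrix κ ι ℂ)
    {ρ : Matrix ι ι ℂ} (hρ : ρ.PosSemidef) :
    (chanApply K ρ).PosSemidef :=
  posSemidef_sum _ fun x _ => hρ.mul_mul_conjTranspose_same (K x)

/-- The Heisenberg-picture dual of the channel with Kraus operators `K`. -/
def chanDual [Fintype κ] (K : X → Matrix κ ι ℂ) (A : Matrix κ κ ℂ) : Matrix ι ι ℂ :=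
  ∑ x, (K x)ᴴ * A * K x

theorem trace_chanApply_mul [Fintype ι] [Fintype κ] (K : X → Matrix κ ι ℂ)
    (ρ : Matrix ι ι ℂ) (A : Matrix κ κ ℂ) :
    (chanApply K ρ * A).trace = (ρ * chanDual K A).trace := by
  simp only [chanApply, chanDual, Finset.sum_mul, Finset.mul_sum, trace_sum]
  refine Finset.sum_congr rfl fun x _ => ?_
  rw [Matrix.mul_assoc, Matrix.mul_assoc, Matrix.trace_mul_comm]
  simp only [Matrix.mul_assoc]

theorem chanDual_conjTranspose [Fintype κ] (K : X → Matrix κ ι ℂ) (A : Matrix κ κ ℂ) :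
    (chanDual K A)ᴴ = chanDual K Aᴴ := by
  simp [chanDual, conjTranspose_sum, Matrix.mul_assoc]

/-- The Kadison–Schwarz inequality, tested against a positive semidefinite matrix. -/
theorem trace_dual_conj_le [Fintype ι] [Fintype κ] [DecidableEq ι] (K : X → Matrix κ ι ℂ)
    (hK : ∑ x, (K x)ᴴ * K x = 1)
    {σ : Matrix ι ι ℂ} (hσ : σ.PosSemidef) (A : Matrix κ κ ℂ) :
    ((chanDual K A)ᴴ * σ * chanDual K A).trace ≤ (Aᴴ * chanApply K σ * A).trace := by
  set Y := chanDual K A with hY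
  have h1 : ∑ x, (Aᴴ * K x - K x * Yᴴ) * σ * (Aᴴ * K x - K x * Yᴴ)ᴴ =
      Aᴴ * chanApply K σ * A - ∑ x, Aᴴ * K x * σ * Y * (K x)ᴴ
        - ∑ x, K x * Yᴴ * σ * (K x)ᴴ * A + ∑ x, K x * Yᴴ * σ * Y * (K x)ᴴ := by
    simp only [chanApply, Finset.sum_mul, Finset.mul_sum, ← Finset.sum_sub_distrib,
      ← Finset.sum_add_distrib]
    refine Finset.sum_congr rfl fun x _ => ?_
    simp only [conjTranspose_sub, conjTranspose_mul, conjTranspose_conjTranspose, Matrix.sub_mul,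
      Matrix.mul_sub, Matrix.mul_assoc]
    abel
  have h2 : (∑ x, Aᴴ * K x * σ * Y * (K x)ᴴ).trace = (Yᴴ * σ * Y).trace := by
    rw [hY, chanDual_conjTranspose, ← hY]
    simp only [chanDual, Finset.sum_mul, trace_sum]
    refine Finset.sum_congr rfl fun x _ => ?_
    rw [Matrix.trace_mul_comm]
    simp only [Matrix.mul_assoc]
  have h3 : (∑ x, K x * Yᴴ * σ * (K x)ᴴ * A).trace = (Yᴴ * σ * Y).trace := by
    change _ = (Yᴴ * σ * ∑ x, (K x)ᴴ * A * K x).trace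
    simp only [Finset.mul_sum, trace_sum]
    refine Finset.sum_congr rfl fun x _ => ?_
    rw [show K x * Yᴴ * σ * (K x)ᴴ * A = K x * (Yᴴ * σ * (K x)ᴴ * A) by
      simp only [Matrix.mul_assoc], Matrix.trace_mul_comm]
    simp only [Matrix.mul_assoc]
  have h4 : (∑ x, K x * Yᴴ * σ * Y * (K x)ᴴ).trace = (Yᴴ * σ * Y).trace := by
    rw [← Matrix.mul_one (Yᴴ * σ * Y), ← hK]
    simp only [Finset.mul_sum, trace_sum]
    refine Finset.sum_congr rfl fun x _ => ?_
    rw [show K x * Yᴴ * σ * Y * (K x)ᴴ = K x * (Yᴴ * σ * Y * (K x)ᴴ) by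
      simp only [Matrix.mul_assoc], Matrix.trace_mul_comm]
    simp only [Matrix.mul_assoc]
  have h5 := (posSemidef_sum Finset.univ fun x _ =>
    hσ.mul_mul_conjTranspose_same (Aᴴ * K x - K x * Yᴴ)).trace_nonneg
  rw [h1, trace_add, trace_sub, trace_sub, h2, h3, h4] at h5
  rw [← sub_nonneg]
  convert h5 using 1
  ring

end Channel

section Marginal

variable {D : ℕ} {α β : Type*} [Fintype α] [Fintype β] [DecidableEq α] [DecidableEq β]

/-- `τ` is the reduced matrix of `ρ` on the `d`-th pair: both give the same expectations to
observables of that pair. -/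
def IsMarginal (ρ : Matrix ((Fin D → α) × (Fin D → β)) ((Fin D → α) × (Fin D → β)) ℂ)
    (d : Fin D) (τ : Matrix (α × β) (α × β) ℂ) : Prop :=
  ∀ A : Matrix (α × β) (α × β) ℂ, (ρ * piKron (Function.update 1 d A)).trace = (τ * A).trace

theorem piKron_update_one_apply (d : Fin D) (A : Matrix (α × β) (α × β) ℂ)
    (v u : (Fin D → α) × (Fin D → β)) :
    piKron (Function.update 1 d A) v u = ∑ p : α × β,
      if u = (Function.update v.1 d p.1, Function.update v.2 d p.2) then
        A (v.1 d, v.2 d) p else 0 := by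
  rw [Finset.sum_eq_single (u.1 d, u.2 d)]
  · rw [piKron, ← Finset.mul_prod_erase _ _ (Finset.mem_univ d), Function.update_self]
    split_ifs with h
    · rw [Finset.prod_eq_one, mul_one]
      intro e he
      have he := Finset.ne_of_mem_erase he
      have h1 := congrFun (congrArg Prod.fst h) e
      have h2 := congrFun (congrArg Prod.snd h) e
      simp only [Function.update_of_ne he] at h1 h2
      rw [Function.update_of_ne he, h1, h2]
      simp
    · have : ∃ e, e ≠ d ∧ ¬ (v.1 e, v.2 e) = (u.1 e, u.2 e) := by
        by_contra! hc
        refine h (Prod.ext (funext fun e => ?_) (funext fun e => ?_))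
        · by_cases he : e = d
          · subst he; simp
          · simpa [he] using (congrArg Prod.fst (hc e he)).symm
        · by_cases he : e = d
          · subst he; simp
          · simpa [he] using (congrArg Prod.snd (hc e he)).symm
      obtain ⟨e, he, hne⟩ := this
      rw [Finset.prod_eq_zero (i := e) (by simp [he]), mul_zero]
      rw [Function.update_of_ne he]
      exact one_apply_ne hne
  · intro p _ hp
    refine if_neg fun h => hp ?_
    have h1 := congrFun (congrArg Prod.fst h) d
    have h2 := congrFun (congrArg Prod.snd h) d
    simp only [Function.update_self] at h1 h2
    exact Prod.ext h1.symm h2.symm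
  · simp

theorem isMarginal_reducePair
    (ρ : Matrix ((Fin D → α) × (Fin D → β)) ((Fin D → α) × (Fin D → β)) ℂ) (d : Fin D) :
    IsMarginal ρ d (reducePair ρ d) := by
  intro A
  simp only [trace, diag_apply, mul_apply, piKron_update_one_apply, reducePair,
    Finset.mul_sum, Finset.sum_mul, mul_ite, mul_zero, ite_mul, zero_mul]
  rw [Finset.sum_comm]
  trans ∑ v : (Fin D → α) × (Fin D → β), ∑ p : α × β,
      ρ (Function.update v.1 d p.1, Function.update v.2 d p.2) v * A (v.1 d, v.2 d) p
  · refine Finset.sum_congr rfl fun v _ => ?_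
    rw [Finset.sum_comm]
    refine Finset.sum_congr rfl fun p _ => ?_
    simp
  · rw [Finset.sum_comm]
    refine Finset.sum_congr rfl fun p _ => ?_
    rw [Fintype.sum_prod_type, Finset.sum_comm' (t' := Finset.univ) (s' := fun _ => Finset.univ)
      (by simp)]
    rw [Finset.sum_comm]
    refine Eq.trans ?_ Finset.sum_comm
    refine Finset.sum_congr rfl fun f _ => ?_
    refine Eq.trans ?_ Finset.sum_comm
    refine Finset.sum_congr rfl fun g _ => ?_
    rw [Finset.sum_eq_single (f d, g d)]
    · simp
    · intro q _ hq
      refine if_neg fun h => hq (Prod.ext h.1.symm h.2.symm)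
    · simp

theorem IsMarginal.posSemidef
    {ρ : Matrix ((Fin D → α) × (Fin D → β)) ((Fin D → α) × (Fin D → β)) ℂ} (hρ : ρ.PosSemidef)
    {d : Fin D} {τ : Matrix (α × β) (α × β) ℂ} (h : IsMarginal ρ d τ) : τ.PosSemidef := by
  have hupd : ∀ A : Matrix (α × β) (α × β) ℂ,
      (piKron (Function.update (1 : Fin D → Matrix (α × β) (α × β) ℂ) d A))ᴴ =
        piKron (Function.update 1 d Aᴴ) := by
    intro A
    rw [piKron_conjTranspose]
    congr 1
    ext1 e
    by_cases he : e = d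
    · subst he; simp
    · simp [he]
  have htr : ∀ A : Matrix (α × β) (α × β) ℂ, (τ * Aᴴ).trace = star (τ * A).trace := by
    intro A
    rw [← h, ← h, ← hupd, ← trace_conjTranspose, conjTranspose_mul, hρ.1.eq, trace_mul_comm]
  have hherm : τ.IsHermitian := by
    ext i j
    have h1 := htr (single i j 1)
    simpa [trace_mul_single] using h1.symm
  refine PosSemidef.of_dotProduct_mulVec_nonneg hherm fun x => ?_
  rcases isEmpty_or_nonempty (α × β) with he | ⟨⟨i⟩⟩
  · simp [dotProduct]
  set C : Matrix (α × β) (α × β) ℂ := vecMulVec x (Pi.single i 1) with hC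
  have h1 : star x ⬝ᵥ (τ *ᵥ x) = (τ * (C * Cᴴ)).trace := by
    rw [hC, conjTranspose_vecMulVec, vecMulVec_mul_vecMulVec, mul_vecMulVec, trace_vecMulVec]
    simp [dotProduct_comm]
  have h2 : piKron (Function.update (1 : Fin D → Matrix (α × β) (α × β) ℂ) d (C * Cᴴ)) =
      piKron (Function.update 1 d C) * (piKron (Function.update 1 d C))ᴴ := by
    rw [hupd, piKron_mul]
    congr 1
    ext1 e
    by_cases he : e = d
    · subst he; simp
    · simp [he]
  rw [h1, ← h, h2, ← Matrix.mul_assoc, trace_mul_comm, ← Matrix.mul_assoc]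
  exact (hρ.conjTranspose_mul_mul_same _).trace_nonneg

end Marginal

section TensorChannel

variable {D : ℕ} {α β α' β' ι : Type*}

variable [Fintype ι]

theorem chanDual_tensorKraus [Fintype α'] [Fintype β'] (K : Fin D → ι → Matrix (α' × β') (α × β) ℂ)
    (A : Fin D → Matrix (α' × β') (α' × β') ℂ) :
    chanDual (tensorKraus K) (piKron A) = piKron fun d => chanDual (K d) (A d) := by
  have h : ∀ i : Fin D → ι, tensorKraus K i = piKron fun d => K d (i d) := fun _ => rfl
  simp only [chanDual, h, piKron_conjTranspose, piKron_mul]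
  exact sum_piKron fun d i => (K d i)ᴴ * A d * K d i

theorem chanApply_tensorKraus [Fintype α] [Fintype β] (K : Fin D → ι → Matrix (α' × β') (α × β) ℂ)
    (A : Fin D → Matrix (α × β) (α × β) ℂ) :
    chanApply (tensorKraus K) (piKron A) = piKron fun d => chanApply (K d) (A d) := by
  have h : ∀ i : Fin D → ι, tensorKraus K i = piKron fun d => K d (i d) := fun _ => rfl
  simp only [chanApply, h, piKron_conjTranspose, piKron_mul]
  exact sum_piKron fun d i => K d i * A d * (K d i)ᴴ

variable [Fintype α'] [Fintype β'] [DecidableEq α] [DecidableEq β] [DecidableEq α'] [DecidableEq β']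

theorem sum_tensorKraus (K : Fin D → ι → Matrix (α' × β') (α × β) ℂ)
    (hK : ∀ d, ∑ i, (K d i)ᴴ * K d i = 1) :
    ∑ i, (tensorKraus K i)ᴴ * tensorKraus K i = 1 := by
  have := chanDual_tensorKraus K 1
  simp only [chanDual, piKron_one, Matrix.mul_one, Pi.one_apply, hK] at this
  rw [this]
  exact piKron_one

theorem IsMarginal.chanApply [Fintype α] [Fintype β]
    {K : Fin D → ι → Matrix (α' × β') (α × β) ℂ}
    (hK : ∀ d, ∑ i, (K d i)ᴴ * K d i = 1)
    {ρ : Matrix ((Fin D → α) × (Fin D → β)) ((Fin D → α) × (Fin D → β)) ℂ}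
    {d : Fin D} {τ : Matrix (α × β) (α × β) ℂ} (h : IsMarginal ρ d τ) :
    IsMarginal (chanApply (tensorKraus K) ρ) d (chanApply (K d) τ) := by
  intro A
  rw [trace_chanApply_mul, trace_chanApply_mul, ← h, chanDual_tensorKraus]
  congr 3
  ext1 e
  by_cases he : e = d
  · subst he; simp
  · simp [he, chanDual, hK]

end TensorChannel

section Scalar

open Filter Topology

variable {k k' : Type*} [Fintype k] [Fintype k']

theorem hasDerivAt_sum_mul_log {c a b : k → ℝ} (ha : ∀ i, c i ≠ 0 → 0 < a i)
    (hb : ∀ i, c i ≠ 0 → 0 < b i) {t : ℝ} (ht : 0 ≤ t) :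
    HasDerivAt (fun t => ∑ i, c i * (Real.log (b i + t * a i) - Real.log (b i)))
      (∑ i, c i * (a i / (b i + t * a i))) t := by
  refine HasDerivAt.fun_sum fun i _ => ?_
  by_cases hc : c i = 0
  · simpa [hc] using hasDerivAt_const t (0 : ℝ)
  · have hpos : 0 < b i + t * a i := add_pos_of_pos_of_nonneg (hb i hc) (mul_nonneg ht (ha i hc).le)
    have h1 : HasDerivAt (fun t => b i + t * a i) (a i) t := by
      simpa using ((hasDerivAt_id t).mul_const (a i)).const_add (b i)
    exact ((h1.log hpos.ne').sub_const _).const_mul _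

theorem tendsto_sum_mul_log {c a b : k → ℝ} (ha : ∀ i, c i ≠ 0 → 0 < a i)
    (hb : ∀ i, c i ≠ 0 → 0 < b i) :
    Tendsto (fun t => ∑ i, c i * (Real.log (b i + t * a i) - Real.log (b i)) -
      (∑ i, c i) * Real.log t) atTop (𝓝 (∑ i, c i * (Real.log (a i) - Real.log (b i)))) := by
  have h : Tendsto (fun t : ℝ => ∑ i, c i * (Real.log (b i / t + a i) - Real.log (b i))) atTop
      (𝓝 (∑ i, c i * (Real.log (a i) - Real.log (b i)))) := by
    refine tendsto_finsetSum _ fun i _ => ?_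
    by_cases hc : c i = 0
    · simp [hc]
    · refine ((Tendsto.log ?_ (ha i hc).ne').sub_const _).const_mul _
      simpa using (tendsto_const_nhds.div_atTop tendsto_id).add_const (a i)
  refine h.congr' ?_
  filter_upwards [eventually_gt_atTop 0] with t ht
  rw [Finset.sum_mul, ← Finset.sum_sub_distrib]
  refine Finset.sum_congr rfl fun i _ => ?_
  by_cases hc : c i = 0
  · simp [hc]
  · have hpos : 0 < b i + t * a i :=
      add_pos_of_pos_of_nonneg (hb i hc) (mul_nonneg ht.le (ha i hc).le)
    rw [show b i / t + a i = (b i + t * a i) / t by field_simp, Real.log_div hpos.ne' ht.ne']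
    ring

/-- A comparison of resolvent sums integrates to a comparison of relative-entropy sums. -/
theorem sum_mul_log_le_of_resolvent_le {c a b : k → ℝ} {c' a' b' : k' → ℝ}
    (ha : ∀ i, c i ≠ 0 → 0 < a i) (hb : ∀ i, c i ≠ 0 → 0 < b i)
    (ha' : ∀ i, c' i ≠ 0 → 0 < a' i) (hb' : ∀ i, c' i ≠ 0 → 0 < b' i)
    (hsum : ∑ i, c' i = ∑ i, c i)
    (h : ∀ t : ℝ, 0 ≤ t →
      ∑ i, c' i * (a' i / (b' i + t * a' i)) ≤ ∑ i, c i * (a i / (b i + t * a i))) :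
    ∑ i, c' i * (Real.log (a' i) - Real.log (b' i)) ≤
      ∑ i, c i * (Real.log (a i) - Real.log (b i)) := by
  refine le_of_tendsto_of_tendsto (tendsto_sum_mul_log ha' hb') (tendsto_sum_mul_log ha hb) ?_
  filter_upwards [eventually_ge_atTop 0] with t ht
  rw [hsum, sub_le_sub_iff_right, ← sub_nonneg]
  have hd : ∀ t : ℝ, 0 ≤ t → HasDerivAt _ _ t := fun t ht =>
    (hasDerivAt_sum_mul_log ha hb ht).sub (hasDerivAt_sum_mul_log ha' hb' ht)
  have hmono := monotoneOn_of_deriv_nonneg (convex_Ici (0 : ℝ))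
    (fun s hs => (hd s hs).continuousAt.continuousWithinAt)
    (fun s hs => (hd s (interior_subset hs)).differentiableAt.differentiableWithinAt)
    (fun s hs => by
      rw [(hd s (interior_subset hs)).deriv]
      exact sub_nonneg.2 (h s (interior_subset hs)))
  simpa using hmono Set.self_mem_Ici ht ht

end Scalar

section Diagonalization

variable {ι κ X : Type*} [Fintype ι] [DecidableEq ι] [Fintype κ] [Fintype X]

/-- `ρ` has eigenvalues `p` in the orthonormal basis given by the columns of `U`. -/
structure IsDiagonalization (ρ U : Matrix ι ι ℂ) (p : ι → ℝ) : Prop where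
  unitary : Uᴴ * U = 1
  eq : ρ = U * diagonal (fun i => (p i : ℂ)) * Uᴴ

theorem IsDiagonalization.unitary' {ρ U : Matrix ι ι ℂ} {p : ι → ℝ}
    (h : IsDiagonalization ρ U p) : U * Uᴴ = 1 :=
  mul_eq_one_comm.1 h.unitary

theorem Matrix.PosSemidef.exists_isDiagonalization {ρ : Matrix ι ι ℂ} (hρ : ρ.PosSemidef) :
    ∃ (U : Matrix ι ι ℂ) (p : ι → ℝ), IsDiagonalization ρ U p ∧ (∀ i, 0 ≤ p i) ∧
      vnEntropy ρ = ∑ i, Real.negMulLog (p i) := by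
  refine ⟨hρ.1.eigenvectorUnitary, hρ.1.eigenvalues, ⟨?_, ?_⟩, hρ.eigenvalues_nonneg, ?_⟩
  · exact Unitary.coe_star_mul_self hρ.1.eigenvectorUnitary
  · exact hρ.1.spectral_theorem
  · rw [vnEntropy, dif_pos hρ.1]

theorem sum_norm_sq_col {W : Matrix ι ι ℂ} (hW : Wᴴ * W = 1) (i : ι) :
    ∑ j, ‖W j i‖ ^ 2 = 1 := by
  have h := congrFun (congrFun hW i) i
  simp only [mul_apply, conjTranspose_apply, one_apply_eq, RCLike.star_def,
    Complex.conj_mul'] at h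
  exact_mod_cast h

theorem IsDiagonalization.unitary_overlap {ρ U σ V : Matrix ι ι ℂ} {p q : ι → ℝ}
    (hρ : IsDiagonalization ρ U p) (hσ : IsDiagonalization σ V q) :
    (Vᴴ * U)ᴴ * (Vᴴ * U) = 1 := by
  rw [conjTranspose_mul, conjTranspose_conjTranspose, Matrix.mul_assoc, ← Matrix.mul_assoc V,
    hσ.unitary', Matrix.one_mul, hρ.unitary]

theorem IsDiagonalization.sum_overlap {ρ U σ V : Matrix ι ι ℂ} {p q : ι → ℝ}
    (hρ : IsDiagonalization ρ U p) (hσ : IsDiagonalization σ V q) (f : ι → ℝ) :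
    ∑ j, ∑ i, ‖(Vᴴ * U) j i‖ ^ 2 * f i = ∑ i, f i := by
  rw [Finset.sum_comm]
  simp only [← Finset.sum_mul, sum_norm_sq_col (hρ.unitary_overlap hσ), one_mul]

theorem IsDiagonalization.posSemidef {ρ U : Matrix ι ι ℂ} {p : ι → ℝ}
    (hρ : IsDiagonalization ρ U p) (hp : ∀ i, 0 ≤ p i) : ρ.PosSemidef := by
  rw [hρ.eq]
  exact (PosSemidef.diagonal fun i => by simpa using hp i).mul_mul_conjTranspose_same U

theorem IsDiagonalization.trace_eq {ρ U : Matrix ι ι ℂ} {p : ι → ℝ}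
    (hρ : IsDiagonalization ρ U p) : ρ.trace = ∑ i, (p i : ℂ) := by
  rw [hρ.eq, trace_mul_comm, ← Matrix.mul_assoc, hρ.unitary, Matrix.one_mul, trace_diagonal]

theorem IsDiagonalization.conj_apply_self {ρ U : Matrix ι ι ℂ} {p : ι → ℝ}
    (hρ : IsDiagonalization ρ U p) (V : Matrix ι ι ℂ) (j : ι) :
    (Vᴴ * ρ * V) j j = ∑ i, ((‖(Vᴴ * U) j i‖ ^ 2 * p i : ℝ) : ℂ) := by
  have h : Vᴴ * ρ * V = Vᴴ * U * diagonal (fun i => (p i : ℂ)) * (Vᴴ * U)ᴴ := by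
    rw [hρ.eq]
    simp only [conjTranspose_mul, conjTranspose_conjTranspose, Matrix.mul_assoc]
  rw [h, mul_apply]
  refine Finset.sum_congr rfl fun i _ => ?_
  rw [mul_diagonal, conjTranspose_apply, RCLike.star_def, mul_right_comm, Complex.mul_conj']
  push_cast
  rfl

/-- The concave functional of `Y` whose supremum is the resolvent sum of `ρ` and `σ` at `t`. -/
def resolventFunctional (ρ σ : Matrix ι ι ℂ) (t : ℝ) (Y : Matrix ι ι ℂ) : ℝ :=
  2 * (ρ * Yᴴ).trace.re - (Yᴴ * σ * Y).trace.re - t * (Y * ρ * Yᴴ).trace.re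

theorem resolventFunctional_eq {ρ U σ V : Matrix ι ι ℂ} {p q : ι → ℝ}
    (hρ : IsDiagonalization ρ U p) (hσ : IsDiagonalization σ V q) (t : ℝ) (y : Matrix ι ι ℂ) :
    resolventFunctional ρ σ t (V * y * Uᴴ) =
      ∑ j, ∑ i, (2 * p i * (star (y j i) * (Vᴴ * U) j i).re -
        (q j + t * p i) * ‖y j i‖ ^ 2) := by
  have h1 : (ρ * (V * y * Uᴴ)ᴴ).trace =
      ∑ j, ∑ i, (p i : ℂ) * (star (y j i) * (Vᴴ * U) j i) := by
    have : (ρ * (V * y * Uᴴ)ᴴ).trace =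
        (diagonal (fun i => (p i : ℂ)) * (yᴴ * (Vᴴ * U))).trace := by
      rw [hρ.eq, show U * diagonal (fun i => (p i : ℂ)) * Uᴴ * (V * y * Uᴴ)ᴴ =
        U * (diagonal (fun i => (p i : ℂ)) * (Uᴴ * U) * yᴴ * Vᴴ) by
          simp only [conjTranspose_mul, conjTranspose_conjTranspose, Matrix.mul_assoc],
        trace_mul_comm, hρ.unitary]
      simp only [Matrix.mul_one, Matrix.mul_assoc]
    rw [this, Finset.sum_comm]
    simp only [trace, diag_apply, diagonal_mul]
    refine Finset.sum_congr rfl fun i _ => ?_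
    rw [mul_apply, Finset.mul_sum]
    rfl
  have h2 : ((V * y * Uᴴ)ᴴ * σ * (V * y * Uᴴ)).trace =
      ∑ j, ∑ i, ((q j * ‖y j i‖ ^ 2 : ℝ) : ℂ) := by
    have : ((V * y * Uᴴ)ᴴ * σ * (V * y * Uᴴ)).trace =
        (diagonal (fun i => (q i : ℂ)) * y * yᴴ).trace := by
      rw [hσ.eq, show (V * y * Uᴴ)ᴴ * (V * diagonal (fun i => (q i : ℂ)) * Vᴴ) * (V * y * Uᴴ) =
        U * (yᴴ * ((Vᴴ * V) * diagonal (fun i => (q i : ℂ)) * (Vᴴ * V) * y * Uᴴ)) by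
          simp only [conjTranspose_mul, conjTranspose_conjTranspose, Matrix.mul_assoc],
        trace_mul_comm, hσ.unitary, Matrix.mul_assoc yᴴ, Matrix.mul_assoc _ Uᴴ, hρ.unitary,
        Matrix.mul_one, Matrix.mul_one, Matrix.one_mul, trace_mul_comm]
    rw [this]
    simp only [trace, diag_apply]
    refine Finset.sum_congr rfl fun j _ => ?_
    rw [mul_apply]
    refine Finset.sum_congr rfl fun i _ => ?_
    rw [diagonal_mul, conjTranspose_apply, RCLike.star_def, mul_assoc, Complex.mul_conj']
    push_cast
    rfl
  have h3 : ((V * y * Uᴴ) * ρ * (V * y * Uᴴ)ᴴ).trace =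
      ∑ j, ∑ i, ((p i * ‖y j i‖ ^ 2 : ℝ) : ℂ) := by
    have : ((V * y * Uᴴ) * ρ * (V * y * Uᴴ)ᴴ).trace =
        (y * diagonal (fun i => (p i : ℂ)) * yᴴ).trace := by
      rw [hρ.eq, show (V * y * Uᴴ) * (U * diagonal (fun i => (p i : ℂ)) * Uᴴ) * (V * y * Uᴴ)ᴴ =
        V * (y * ((Uᴴ * U) * diagonal (fun i => (p i : ℂ)) * (Uᴴ * U) * yᴴ * Vᴴ)) by
          simp only [conjTranspose_mul, conjTranspose_conjTranspose, Matrix.mul_assoc],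
        trace_mul_comm, hρ.unitary, Matrix.mul_assoc y, Matrix.mul_assoc _ Vᴴ, hσ.unitary,
        Matrix.mul_one, Matrix.mul_one, Matrix.one_mul, Matrix.mul_assoc]
    rw [this]
    simp only [trace, diag_apply]
    refine Finset.sum_congr rfl fun j _ => ?_
    rw [mul_apply]
    refine Finset.sum_congr rfl fun i _ => ?_
    rw [mul_diagonal, conjTranspose_apply, RCLike.star_def, mul_right_comm, Complex.mul_conj']
    push_cast
    ring
  rw [resolventFunctional, h1, h2, h3]
  simp only [← Complex.ofReal_sum, Complex.ofReal_re, Complex.re_sum, Complex.re_ofReal_mul,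
    Finset.mul_sum, ← Finset.sum_sub_distrib]
  refine Finset.sum_congr rfl fun j _ => Finset.sum_congr rfl fun i _ => ?_
  ring

theorem resolventFunctional_le {ρ U σ V : Matrix ι ι ℂ} {p q : ι → ℝ}
    (hρ : IsDiagonalization ρ U p) (hσ : IsDiagonalization σ V q)
    (hp : ∀ i, 0 ≤ p i) (hq : ∀ i, 0 ≤ q i) {t : ℝ} (ht : 0 ≤ t)
    (hpq : ∀ i j, (Vᴴ * U) j i ≠ 0 → p i ≠ 0 → q j ≠ 0) (Y : Matrix ι ι ℂ) :
    resolventFunctional ρ σ t Y ≤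
      ∑ j, ∑ i, ‖(Vᴴ * U) j i‖ ^ 2 * p i * (p i / (q j + t * p i)) := by
  have hY : Y = V * (Vᴴ * Y * U) * Uᴴ := by
    rw [show V * (Vᴴ * Y * U) * Uᴴ = (V * Vᴴ) * Y * (U * Uᴴ) by simp only [Matrix.mul_assoc],
      hσ.unitary', hρ.unitary', Matrix.one_mul, Matrix.mul_one]
  rw [hY, resolventFunctional_eq hρ hσ]
  refine Finset.sum_le_sum fun j _ => Finset.sum_le_sum fun i _ => ?_
  generalize (Vᴴ * Y * U) j i = y
  have hw := hpq i j
  generalize (Vᴴ * U) j i = w at hw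
  have h1 : (star y * w).re ≤ ‖y‖ * ‖w‖ := by
    refine (Complex.re_le_norm _).trans ?_
    rw [norm_mul, norm_star]
  have h2 : 2 * p i * (star y * w).re ≤ 2 * p i * (‖y‖ * ‖w‖) :=
    mul_le_mul_of_nonneg_left h1 (by linarith [hp i])
  have hs : 0 ≤ q j + t * p i := add_nonneg (hq j) (mul_nonneg ht (hp i))
  rcases hs.eq_or_lt with h0 | hpos
  · have hz : p i * ‖w‖ = 0 := by
      by_contra hne
      have hqj := hw (fun h => hne (by simp [h])) (left_ne_zero_of_mul hne)
      have : 0 < q j := lt_of_le_of_ne (hq j) (Ne.symm hqj)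
      linarith [mul_nonneg ht (hp i)]
    rw [← h0, div_zero, mul_zero, zero_mul, sub_zero]
    refine h2.trans (le_of_eq ?_)
    linear_combination 2 * ‖y‖ * hz
  · have h3 : ‖w‖ ^ 2 * p i * (p i / (q j + t * p i)) - 2 * p i * (‖y‖ * ‖w‖) +
        (q j + t * p i) * ‖y‖ ^ 2 =
        (q j + t * p i) * (‖y‖ - ‖w‖ * p i / (q j + t * p i)) ^ 2 := by
      generalize q j + t * p i = s at hpos
      field_simp
      ring
    have h4 := mul_nonneg hs (sq_nonneg (‖y‖ - ‖w‖ * p i / (q j + t * p i)))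
    linarith

theorem exists_resolventFunctional_eq {ρ U σ V : Matrix ι ι ℂ} {p q : ι → ℝ}
    (hρ : IsDiagonalization ρ U p) (hσ : IsDiagonalization σ V q) (t : ℝ) :
    ∃ Y, resolventFunctional ρ σ t Y =
      ∑ j, ∑ i, ‖(Vᴴ * U) j i‖ ^ 2 * p i * (p i / (q j + t * p i)) := by
  refine ⟨V * (Matrix.of fun j i => ((p i / (q j + t * p i) : ℝ) : ℂ) * (Vᴴ * U) j i) * Uᴴ, ?_⟩
  rw [resolventFunctional_eq hρ hσ]
  refine Finset.sum_congr rfl fun j _ => Finset.sum_congr rfl fun i _ => ?_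
  rw [of_apply]
  generalize (Vᴴ * U) j i = w
  have h1 : (star (((p i / (q j + t * p i) : ℝ) : ℂ) * w) * w).re =
      p i / (q j + t * p i) * ‖w‖ ^ 2 := by
    rw [star_mul', RCLike.star_def, Complex.conj_ofReal, mul_assoc,
      Complex.conj_mul', Complex.re_ofReal_mul]
    norm_cast
  rw [h1, norm_mul, Complex.norm_real, mul_pow, Real.norm_eq_abs, sq_abs]
  by_cases h : q j + t * p i = 0
  · simp [h]
  · field_simp
    ring

theorem resolventFunctional_chanApply_le (K : X → Matrix κ ι ℂ) (hK : ∑ x, (K x)ᴴ * K x = 1)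
    {ρ σ : Matrix ι ι ℂ} (hρ : ρ.PosSemidef) (hσ : σ.PosSemidef) {t : ℝ} (ht : 0 ≤ t)
    (Y : Matrix κ κ ℂ) :
    resolventFunctional (chanApply K ρ) (chanApply K σ) t Y ≤
      resolventFunctional ρ σ t (chanDual K Y) := by
  have h1 := (Complex.le_def.1 (trace_dual_conj_le K hK hσ Y)).1
  have h2 := (Complex.le_def.1 (trace_dual_conj_le K hK hρ Yᴴ)).1
  rw [← chanDual_conjTranspose, conjTranspose_conjTranspose, conjTranspose_conjTranspose] at h2
  simp only [resolventFunctional]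
  rw [trace_chanApply_mul, ← chanDual_conjTranspose]
  have h3 := mul_le_mul_of_nonneg_left h2 ht
  linarith

/-- Monotonicity of the quantum relative entropy under channels, in terms of diagonalizations. -/
theorem relEntropy_chanApply_le [DecidableEq κ] (K : X → Matrix κ ι ℂ) (hK : ∑ x, (K x)ᴴ * K x = 1)
    {ρ U σ V : Matrix ι ι ℂ} {p q : ι → ℝ} (hρ : IsDiagonalization ρ U p)
    (hσ : IsDiagonalization σ V q) (hp : ∀ i, 0 ≤ p i) (hq : ∀ i, 0 ≤ q i)
    (hpq : ∀ i j, (Vᴴ * U) j i ≠ 0 → p i ≠ 0 → q j ≠ 0)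
    {U' V' : Matrix κ κ ℂ} {p' q' : κ → ℝ} (hρ' : IsDiagonalization (chanApply K ρ) U' p')
    (hσ' : IsDiagonalization (chanApply K σ) V' q') (hp' : ∀ i, 0 ≤ p' i) (hq' : ∀ i, 0 ≤ q' i)
    (hpq' : ∀ i j, (V'ᴴ * U') j i ≠ 0 → p' i ≠ 0 → q' j ≠ 0) :
    ∑ j, ∑ i, ‖(V'ᴴ * U') j i‖ ^ 2 * p' i * (Real.log (p' i) - Real.log (q' j)) ≤
      ∑ j, ∑ i, ‖(Vᴴ * U) j i‖ ^ 2 * p i * (Real.log (p i) - Real.log (q j)) := by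
  have htot : ∑ x : κ × κ, ‖(V'ᴴ * U') x.1 x.2‖ ^ 2 * p' x.2 =
      ∑ x : ι × ι, ‖(Vᴴ * U) x.1 x.2‖ ^ 2 * p x.2 := by
    rw [Fintype.sum_prod_type, Fintype.sum_prod_type, hρ.sum_overlap hσ, hρ'.sum_overlap hσ']
    have h := trace_chanApply_mul K ρ 1
    simp only [chanDual, Matrix.mul_one, hK, hρ.trace_eq, hρ'.trace_eq] at h
    exact_mod_cast h
  have key := sum_mul_log_le_of_resolvent_le
    (c := fun x : ι × ι => ‖(Vᴴ * U) x.1 x.2‖ ^ 2 * p x.2) (a := fun x => p x.2)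
    (b := fun x => q x.1) (c' := fun x : κ × κ => ‖(V'ᴴ * U') x.1 x.2‖ ^ 2 * p' x.2)
    (a' := fun x => p' x.2) (b' := fun x => q' x.1)
    (fun x hx => (hp x.2).lt_of_ne' (right_ne_zero_of_mul hx))
    (fun x hx => (hq x.1).lt_of_ne' (hpq x.2 x.1
      (fun h => left_ne_zero_of_mul hx (by simp [h])) (right_ne_zero_of_mul hx)))
    (fun x hx => (hp' x.2).lt_of_ne' (right_ne_zero_of_mul hx))
    (fun x hx => (hq' x.1).lt_of_ne' (hpq' x.2 x.1
      (fun h => left_ne_zero_of_mul hx (by simp [h])) (right_ne_zero_of_mul hx)))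
    htot fun t ht => by
      simp only [Fintype.sum_prod_type]
      obtain ⟨Y, hY⟩ := exists_resolventFunctional_eq hρ' hσ' t
      rw [← hY]
      exact (resolventFunctional_chanApply_le K hK (hρ.posSemidef hp) (hσ.posSemidef hq) ht Y).trans
        (resolventFunctional_le hρ hσ hp hq ht hpq _)
  simpa only [Fintype.sum_prod_type] using key

end Diagonalization

section TensorDiagonalization

variable {D : ℕ} {α β : Type*} [Fintype α] [Fintype β] [DecidableEq α] [DecidableEq β]

theorem IsDiagonalization.piKron {τ V : Fin D → Matrix (α × β) (α × β) ℂ}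
    {q : Fin D → α × β → ℝ} (h : ∀ d, IsDiagonalization (τ d) (V d) (q d)) :
    IsDiagonalization (piKron τ) (piKron V) fun j => ∏ d, q d (j.1 d, j.2 d) where
  unitary := by
    rw [piKron_conjTranspose, piKron_mul]
    simp only [(h _).unitary]
    exact piKron_one
  eq := by
    have hd := piKron_diagonal fun d a => (q d a : ℂ)
    push_cast
    rw [← hd, piKron_conjTranspose, piKron_mul, piKron_mul]
    exact congrArg _ (funext fun d => (h d).eq)

variable {ρ U : Matrix ((Fin D → α) × (Fin D → β)) ((Fin D → α) × (Fin D → β)) ℂ}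
  {p : (Fin D → α) × (Fin D → β) → ℝ} {τ V : Fin D → Matrix (α × β) (α × β) ℂ}
  {q : Fin D → α × β → ℝ}

theorem sum_overlap_marginal (hρ : IsDiagonalization ρ U p)
    (hτ : ∀ d, IsDiagonalization (τ d) (V d) (q d)) (hm : ∀ d, IsMarginal ρ d (τ d))
    (d : Fin D) (f : α × β → ℝ) :
    ∑ j, (∑ i, ‖((piKron V)ᴴ * U) j i‖ ^ 2 * p i) * f (j.1 d, j.2 d) = ∑ a, q d a * f a := by
  have h := hm d (V d * diagonal (fun a => (f a : ℂ)) * (V d)ᴴ)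
  have h1 : piKron (Function.update 1 d (V d * diagonal (fun a => (f a : ℂ)) * (V d)ᴴ)) =
      piKron V * diagonal (fun j => (f (j.1 d, j.2 d) : ℂ)) * (piKron V)ᴴ := by
    have hd := piKron_diagonal (Function.update (fun (_ : Fin D) (_ : α × β) => (1 : ℂ)) d
      fun a => (f a : ℂ))
    have hprod : ∀ j : (Fin D → α) × (Fin D → β),
        ∏ e, Function.update (fun (_ : Fin D) (_ : α × β) => (1 : ℂ)) d (fun a => (f a : ℂ)) e
          (j.1 e, j.2 e) = f (j.1 d, j.2 d) := fun j => by
      rw [Finset.prod_eq_single d]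
      · simp
      · intro e _ he
        simp [he]
      · simp
    simp only [hprod] at hd
    rw [← hd, piKron_conjTranspose, piKron_mul, piKron_mul]
    congr 1
    ext1 e
    by_cases he : e = d
    · subst he; simp
    · simp [he, (hτ e).unitary']
  have h2 : (τ d * (V d * diagonal (fun a => (f a : ℂ)) * (V d)ᴴ)).trace =
      ∑ a, (q d a : ℂ) * f a := by
    rw [(hτ d).eq, show V d * diagonal (fun i => (q d i : ℂ)) * (V d)ᴴ *
      (V d * diagonal (fun a => (f a : ℂ)) * (V d)ᴴ) = V d * (diagonal (fun i => (q d i : ℂ)) *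
        ((V d)ᴴ * V d) * diagonal (fun a => (f a : ℂ)) * (V d)ᴴ) by simp only [Matrix.mul_assoc],
      trace_mul_comm, (hτ d).unitary, Matrix.mul_assoc _ _ (V d), (hτ d).unitary]
    simp [trace_diagonal]
  have h3 : (ρ * (piKron V *
      diagonal (fun j : (Fin D → α) × (Fin D → β) => (f (j.1 d, j.2 d) : ℂ)) * (piKron V)ᴴ)).trace =
      ∑ j, ((∑ i, ‖((piKron V)ᴴ * U) j i‖ ^ 2 * p i : ℝ) : ℂ) * f (j.1 d, j.2 d) := by
    rw [← Matrix.mul_assoc, trace_mul_comm, ← Matrix.mul_assoc, ← Matrix.mul_assoc]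
    simp only [trace, diag_apply, mul_diagonal, hρ.conj_apply_self, Complex.ofReal_sum]
  rw [h1, h2, h3] at h
  exact_mod_cast h

theorem eigenvalue_ne_zero_of_overlap (hρ : IsDiagonalization ρ U p) (hp : ∀ i, 0 ≤ p i)
    (hτ : ∀ d, IsDiagonalization (τ d) (V d) (q d)) (hm : ∀ d, IsMarginal ρ d (τ d))
    {i j : (Fin D → α) × (Fin D → β)} (hw : ((piKron V)ᴴ * U) j i ≠ 0) (hpi : p i ≠ 0)
    (d : Fin D) : q d (j.1 d, j.2 d) ≠ 0 := by
  intro h0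
  have h := sum_overlap_marginal hρ hτ hm d (Pi.single (j.1 d, j.2 d) 1)
  have hr : ∀ j, 0 ≤ ∑ i, ‖((piKron V)ᴴ * U) j i‖ ^ 2 * p i := fun j =>
    Finset.sum_nonneg fun i _ => mul_nonneg (sq_nonneg _) (hp i)
  have hrhs : ∑ a, q d a * (Pi.single (j.1 d, j.2 d) 1 : α × β → ℝ) a = 0 := by
    simp [Pi.single_apply, h0]
  rw [hrhs, Finset.sum_eq_zero_iff_of_nonneg] at h
  · have hj := h j (Finset.mem_univ j)
    rw [Pi.single_eq_same, mul_one, Finset.sum_eq_zero_iff_of_nonneg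
      fun i _ => mul_nonneg (sq_nonneg _) (hp i)] at hj
    have := hj i (Finset.mem_univ i)
    simp [hw, hpi] at this
  · intro k _
    refine mul_nonneg (hr k) ?_
    rw [Pi.single_apply]
    split_ifs <;> norm_num

/-- The relative entropy of a multipartite state with respect to the product of its marginals is
the difference of entropies. -/
theorem relEntropy_marginals (hρ : IsDiagonalization ρ U p) (hp : ∀ i, 0 ≤ p i)
    (hτ : ∀ d, IsDiagonalization (τ d) (V d) (q d)) (hm : ∀ d, IsMarginal ρ d (τ d)) :
    ∑ j, ∑ i, ‖((piKron V)ᴴ * U) j i‖ ^ 2 * p i *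
        (Real.log (p i) - Real.log (∏ d, q d (j.1 d, j.2 d))) =
      ∑ d, ∑ a, Real.negMulLog (q d a) - ∑ i, Real.negMulLog (p i) := by
  have h1 := hρ.sum_overlap (IsDiagonalization.piKron hτ) fun i => p i * Real.log (p i)
  have h2 : ∑ j, ∑ i, ‖((piKron V)ᴴ * U) j i‖ ^ 2 * p i *
      Real.log (∏ d, q d (j.1 d, j.2 d)) = ∑ d, ∑ a, q d a * Real.log (q d a) := by
    simp only [← sum_overlap_marginal hρ hτ hm]
    rw [Finset.sum_comm (s := (Finset.univ : Finset (Fin D)))]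
    refine Finset.sum_congr rfl fun j _ => ?_
    rw [← Finset.mul_sum, Finset.sum_mul]
    refine Finset.sum_congr rfl fun i _ => ?_
    by_cases hw : ((piKron V)ᴴ * U) j i = 0
    · simp [hw]
    by_cases hpi : p i = 0
    · simp [hpi]
    rw [Real.log_prod fun d _ => eigenvalue_ne_zero_of_overlap hρ hp hτ hm hw hpi d]
  simp only [Real.negMulLog, neg_mul, Finset.sum_neg_distrib]
  simp only [mul_sub, Finset.sum_sub_distrib, h2]
  simp only [mul_assoc, h1]
  ring

end TensorDiagonalization

/-- Superadditivity of entropy gain I: the entropy gain of a tensor-product channel on a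
multipartite state is at least the sum of the entropy gains on the reduced states. -/
theorem stmt5 (D : ℕ) (hD : 1 ≤ D) {ιA ιB ιA' ιB' ι : Type*}
    [Fintype ιA] [DecidableEq ιA] [Fintype ιB] [DecidableEq ιB]
    [Fintype ιA'] [DecidableEq ιA'] [Fintype ιB'] [DecidableEq ιB'] [Fintype ι]
    (K : Fin D → ι → Matrix (ιA' × ιB') (ιA × ιB) ℂ)
    (hK : ∀ d : Fin D, ∑ i, (K d i)ᴴ * K d i = 1)
    (ρ : Matrix ((Fin D → ιA) × (Fin D → ιB)) ((Fin D → ιA) × (Fin D → ιB)) ℂ)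
    (hρ : IsDensityMatrix ρ) :
    vnEntropy (chanApply (tensorKraus K) ρ) - vnEntropy ρ ≥
      ∑ d : Fin D,
        (vnEntropy (chanApply (K d) (reducePair ρ d)) - vnEntropy (reducePair ρ d)) := by
  have hρ0 := hρ.1
  have hτ0 : ∀ d, (reducePair ρ d).PosSemidef := fun d =>
    (isMarginal_reducePair ρ d).posSemidef hρ0
  obtain ⟨U, p, hU, hp, hS⟩ := hρ0.exists_isDiagonalization
  obtain ⟨U', p', hU', hp', hS'⟩ :=
    (chanApply_posSemidef (tensorKraus K) hρ0).exists_isDiagonalization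
  choose V q hV hq hSq using fun d => (hτ0 d).exists_isDiagonalization
  choose V' q' hV' hq' hSq' using fun d =>
    (chanApply_posSemidef (K d) (hτ0 d)).exists_isDiagonalization
  have hm := isMarginal_reducePair ρ
  have hm' := fun d => (hm d).chanApply hK
  have hVt := IsDiagonalization.piKron hV
  have hVt' := IsDiagonalization.piKron hV'
  rw [← chanApply_tensorKraus] at hVt'
  have h := relEntropy_chanApply_le (tensorKraus K) (sum_tensorKraus K hK) hU hVt hp
    (fun j => Finset.prod_nonneg fun d _ => hq d _)
    (fun i j hw hpi => Finset.prod_ne_zero_iff.2 fun d _ =>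
      eigenvalue_ne_zero_of_overlap hU hp hV hm hw hpi d)
    hU' hVt' hp' (fun j => Finset.prod_nonneg fun d _ => hq' d _)
    (fun i j hw hpi => Finset.prod_ne_zero_iff.2 fun d _ =>
      eigenvalue_ne_zero_of_overlap hU' hp' hV' hm' hw hpi d)
  rw [relEntropy_marginals hU hp hV hm, relEntropy_marginals hU' hp' hV' hm'] at h
  simp only [hS, hS', hSq, hSq', Finset.sum_sub_distrib]
  linarith
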